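/- The C*-algebra generated in B(L²(𝕋^N → ℂ^M)) by all finite difference operators D_{i,h} (i ∈ {1,...,N}, h ∈ ℚ \ {0}) together with all multiplication operators M_S by regulated matrix-valued functions with rational discontinuities equals the closure of the increasing union ⋃_{n≥1} H^{1/n!}, where H^{1/p} is the finite-dimensional algebra of cube-step-coefficient shift operators of step 1/p. -/

import Mathlib

open MeasureTheory

noncomputable section

abbrev Torus (N : ℕ) := Fin N → AddCircle (1 : ℝ)

abbrev L2 (N M : ℕ) := Lp (EuclideanSpace ℂ (Fin M)) 2 (volume : Measure (Torus N))

/-- The canonical representative in `[0,1)` of a point of `𝕋 = ℝ/ℤ`. -/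
def lift1 (x : AddCircle (1 : ℝ)) : ℝ := (AddCircle.equivIco 1 0 x : ℝ)

/-- The index of the cube of side `1/p` containing `x ∈ 𝕋^N`. -/
def cubeIdxZ (N p : ℕ) (x : Torus N) : Fin N → ℤ := fun i => ⌊lift1 (x i) * p⌋

/-- The shift vector `j/p ∈ 𝕋^N` for `j ∈ {0,…,p−1}^N`. -/
def hvecF (N p : ℕ) (j : Fin N → Fin p) : Torus N :=
  fun i => ((((j i : ℕ) : ℝ) / p : ℝ) : AddCircle (1 : ℝ))

/-- `(A u)(x) = Σ_{j} A_j(x) u(x + j/p)` with the step coefficient `A_j` having constant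
value `C j r` on the cube of side `1/p` indexed by `r`. -/
def opOfF (N M p : ℕ)
    (C : (Fin N → Fin p) → (Fin N → ℤ) → Matrix (Fin M) (Fin M) ℂ)
    (u : Torus N → EuclideanSpace ℂ (Fin M)) : Torus N → EuclideanSpace ℂ (Fin M) :=
  fun x => ∑ j : Fin N → Fin p,
    Matrix.toEuclideanCLM (𝕜 := ℂ) (C j (cubeIdxZ N p x)) (u (x + hvecF N p j))

/-- The finite-dimensional algebra `H^{1/p}` of shift operators with cube-step
coefficients of step `1/p`. -/
def HsetF (N M p : ℕ) : Set (L2 N M →L[ℂ] L2 N M) :=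
  {T | ∃ C, ∀ u : L2 N M,
    (T u : Torus N → EuclideanSpace ℂ (Fin M)) =ᵐ[volume] opOfF N M p C u}

/-- A rational step function on `𝕋^N`. -/
def IsRatStep (N M : ℕ) (S : Torus N → Matrix (Fin M) (Fin M) ℂ) : Prop :=
  ∃ (P : ℕ) (a b : Fin P → Fin N → ℚ) (V : Fin P → Matrix (Fin M) (Fin M) ℂ),
    ∀ x, S x = ∑ n : Fin P,
      Set.indicator {y : Torus N | ∀ i, (a n i : ℝ) ≤ lift1 (y i) ∧ lift1 (y i) < (b n i : ℝ)}
        (fun _ => V n) x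

/-- A regulated matrix-valued function with rational discontinuities: a uniform limit of
rational step functions. -/
def IsRegulated (N M : ℕ) (S : Torus N → Matrix (Fin M) (Fin M) ℂ) : Prop :=
  ∀ ε > (0 : ℝ), ∃ S', IsRatStep N M S' ∧
    ∀ (x : Torus N) (a b : Fin M), ‖S x a b - S' x a b‖ < ε

/-- The generators of the algebra of finite PDEs: finite difference operators `D_{i,h}`
(`h ∈ ℚ \ {0}`) and multiplication operators `M_S` by regulated functions with rational
discontinuities. -/
def PDEGen (N M : ℕ) : Set (L2 N M →L[ℂ] L2 N M) :=
  {T | (∃ (i : Fin N) (h : ℚ), h ≠ 0 ∧ ∀ u : L2 N M,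
          (T u : Torus N → EuclideanSpace ℂ (Fin M)) =ᵐ[volume]
            fun x => ((h : ℝ) : ℂ)⁻¹ •
              (u (x + Pi.single i ((h : ℝ) : AddCircle (1 : ℝ))) - u x)) ∨
       (∃ S : Torus N → Matrix (Fin M) (Fin M) ℂ, IsRegulated N M S ∧
          ∀ u : L2 N M,
            (T u : Torus N → EuclideanSpace ℂ (Fin M)) =ᵐ[volume]
              fun x => Matrix.toEuclideanCLM (𝕜 := ℂ) (S x) (u x))}

open scoped ENNReal

lemma lift1_mem (x : AddCircle (1 : ℝ)) : lift1 x ∈ Set.Ico (0 : ℝ) 1 := by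
  simpa only [lift1, zero_add] using (AddCircle.equivIco (1 : ℝ) 0 x).2

lemma coe_lift1 (x : AddCircle (1 : ℝ)) : ((lift1 x : ℝ) : AddCircle (1 : ℝ)) = x :=
  (AddCircle.equivIco 1 0).symm_apply_apply x

lemma lift1_coe (t : ℝ) : lift1 (t : AddCircle (1 : ℝ)) = Int.fract t := by
  simp [lift1, AddCircle.coe_equivIco_mk_apply]

lemma measurable_lift1 : Measurable lift1 :=
  measurable_subtype_coe.comp (AddCircle.measurableEquivIco 1 0).measurable

lemma floor_lift1_add {p : ℕ} (hp : 0 < p) (x : AddCircle (1 : ℝ)) (j : ℤ) :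
    ⌊lift1 (x + (((j : ℝ) / p : ℝ) : AddCircle (1 : ℝ))) * p⌋ = (⌊lift1 x * p⌋ + j) % p := by
  have hp' : (p : ℝ) ≠ 0 := by positivity
  obtain ⟨t, rfl⟩ : ∃ t : ℝ, (t : AddCircle (1 : ℝ)) = x := ⟨_, coe_lift1 x⟩
  have key (s : ℝ) : ⌊Int.fract s * p⌋ = ⌊s * p⌋ % p := by
    have h : Int.fract s * p = s * p - ((⌊s⌋ * p : ℤ) : ℝ) := by
      push_cast; rw [Int.fract]; ring
    have hs : ⌊s⌋ = ⌊s * p⌋ / p := by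
      rw [← Int.floor_div_natCast, mul_div_cancel_right₀ _ hp']
    rw [h, Int.floor_sub_intCast, hs, Int.emod_def, mul_comm (p : ℤ)]
  rw [← AddCircle.coe_add, lift1_coe, lift1_coe, key, key, add_mul, div_mul_cancel₀ _ hp',
    Int.floor_add_intCast, Int.emod_add_emod]

/-- The point `j/p` of the torus, for an integer vector `j`. -/
def gridVec (N p : ℕ) (j : Fin N → ℤ) : Torus N :=
  fun i => (((j i : ℝ) / p : ℝ) : AddCircle (1 : ℝ))

lemma cubeIdxZ_add {N p : ℕ} (hp : 0 < p) (x : Torus N) (j : Fin N → ℤ) :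
    cubeIdxZ N p (x + gridVec N p j) =
      fun i => (cubeIdxZ N p x i + j i) % p :=
  funext fun i => floor_lift1_add hp (x i) (j i)

lemma cubeIdxZ_mem {N p : ℕ} (hp : 0 < p) (x : Torus N) (i : Fin N) :
    cubeIdxZ N p x i ∈ Set.Ico (0 : ℤ) p := by
  have h := lift1_mem (x i)
  have hp' : (0 : ℝ) < p := by exact_mod_cast hp
  refine ⟨Int.floor_nonneg.2 (mul_nonneg h.1 hp'.le), Int.floor_lt.2 ?_⟩
  have := h.2
  push_cast
  nlinarith

lemma cubeIdxZ_of_mul {N p m : ℕ} (hm : 0 < m) (x : Torus N) :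
    cubeIdxZ N p x = fun i => cubeIdxZ N (p * m) x i / m := by
  funext i
  have hm' : (m : ℝ) ≠ 0 := by positivity
  rw [cubeIdxZ, cubeIdxZ, ← Int.floor_div_natCast]
  congr 1
  push_cast
  field_simp

lemma measurable_cubeIdxZ (N p : ℕ) : Measurable (cubeIdxZ N p) :=
  measurable_pi_lambda _ fun i =>
    ((measurable_lift1.comp (measurable_pi_apply i)).mul_const _).floor

lemma memLp_cubeStep {N M p : ℕ} (hp : 0 < p) (c : (Fin N → ℤ) → Matrix (Fin M) (Fin M) ℂ) :
    MemLp (fun x => Matrix.toEuclideanCLM (𝕜 := ℂ) (c (cubeIdxZ N p x))) ∞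
      (volume : Measure (Torus N)) := by
  have hfin : (Set.univ.pi fun _ : Fin N => Set.Ico (0 : ℤ) p).Finite :=
    Set.Finite.pi fun _ => Set.finite_Ico _ _
  obtain ⟨K, hK⟩ := (hfin.image fun r => ‖Matrix.toEuclideanCLM (𝕜 := ℂ) (c r)‖).bddAbove
  refine memLp_top_of_bound
    ((StronglyMeasurable.of_discrete
      (f := fun r => Matrix.toEuclideanCLM (𝕜 := ℂ) (c r))).comp_measurable
      (measurable_cubeIdxZ N p)).aestronglyMeasurable K (.of_forall fun x => ?_)
  exact hK ⟨_, fun i _ => cubeIdxZ_mem hp x i, rfl⟩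

/-- Multiplication by the step function with value `c r` on the cube of side `1/p` indexed
by `r`. -/
def mulOp (N M p : ℕ) [NeZero p] (c : (Fin N → ℤ) → Matrix (Fin M) (Fin M) ℂ) :
    L2 N M →L[ℂ] L2 N M :=
  (ContinuousLinearMap.id ℂ (EuclideanSpace ℂ (Fin M) →L[ℂ] EuclideanSpace ℂ (Fin M))).holderL
    volume ∞ 2 2 ((memLp_cubeStep (NeZero.pos p) c).toLp _)

lemma coeFn_mulOp {N M : ℕ} (p : ℕ) [NeZero p] (c : (Fin N → ℤ) → Matrix (Fin M) (Fin M) ℂ)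
    (u : L2 N M) : (mulOp N M p c u : Torus N → EuclideanSpace ℂ (Fin M)) =ᵐ[volume]
      fun x => Matrix.toEuclideanCLM (𝕜 := ℂ) (c (cubeIdxZ N p x)) (u x) := by
  filter_upwards [ContinuousLinearMap.coeFn_holder (r := 2)
    (ContinuousLinearMap.id ℂ (EuclideanSpace ℂ (Fin M) →L[ℂ] EuclideanSpace ℂ (Fin M)))
    ((memLp_cubeStep (NeZero.pos p) c).toLp _) u,
    (memLp_cubeStep (NeZero.pos p) c).coeFn_toLp] with x h1 h2
  refine h1.trans ?_
  rw [h2]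
  rfl

/-- Translation by `h`, as a linear isometry. -/
def translₗᵢ (N M : ℕ) (h : Torus N) : L2 N M →ₗᵢ[ℂ] L2 N M :=
  Lp.compMeasurePreservingₗᵢ ℂ (· + h) (measurePreserving_add_right volume h)

/-- Translation by `h`. -/
def transl (N M : ℕ) (h : Torus N) : L2 N M →L[ℂ] L2 N M :=
  (translₗᵢ N M h).toContinuousLinearMap

lemma coeFn_transl {N M : ℕ} (h : Torus N) (u : L2 N M) :
    (transl N M h u : Torus N → EuclideanSpace ℂ (Fin M)) =ᵐ[volume] fun x => u (x + h) :=
  Lp.coeFn_compMeasurePreserving u (measurePreserving_add_right volume h)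

lemma ae_comp_add {N : ℕ} {β : Type*} {f g : Torus N → β} (h : Torus N) (hfg : f =ᵐ[volume] g) :
    (fun x => f (x + h)) =ᵐ[volume] fun x => g (x + h) :=
  (measurePreserving_add_right volume h).quasiMeasurePreserving.ae_eq_comp hfg

lemma transl_zero (N M : ℕ) : transl N M 0 = 1 := by
  ext1 u
  refine Lp.ext ((coeFn_transl 0 u).trans ?_)
  simp

lemma transl_add {N M : ℕ} (h k : Torus N) :
    transl N M (h + k) = transl N M h * transl N M k := by
  ext1 u
  refine Lp.ext ((coeFn_transl _ u).trans ?_)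
  filter_upwards [coeFn_transl h (transl N M k u), ae_comp_add h (coeFn_transl k u)] with x h1 h2
  simp only [mul_apply_eq_comp, h1, h2, add_assoc]

lemma star_transl {N M : ℕ} (h : Torus N) : star (transl N M h) = transl N M (-h) := by
  symm
  rw [ContinuousLinearMap.star_eq_adjoint, ContinuousLinearMap.eq_adjoint_iff]
  intro u v
  have h1 : inner ℂ (transl N M h (transl N M (-h) u)) (transl N M h v)
      = inner ℂ (transl N M (-h) u) v :=
    (translₗᵢ N M h).inner_map_map _ _
  rw [← h1, ← mul_apply_eq_comp, ← transl_add, add_neg_cancel, transl_zero]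
  rfl

lemma mulOp_one (N M p : ℕ) [NeZero p] : mulOp N M p 1 = 1 := by
  ext1 u
  refine Lp.ext ((coeFn_mulOp p _ u).trans ?_)
  simp

lemma mulOp_mul {N M p : ℕ} [NeZero p] (c d : (Fin N → ℤ) → Matrix (Fin M) (Fin M) ℂ) :
    mulOp N M p c * mulOp N M p d = mulOp N M p (c * d) := by
  ext1 u
  refine Lp.ext (((coeFn_mulOp p c (mulOp N M p d u))).trans ?_)
  filter_upwards [coeFn_mulOp p d u, coeFn_mulOp p (c * d) u] with x h1 h2
  rw [h1, h2, Pi.mul_apply, map_mul, mul_apply_eq_comp]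

lemma star_mulOp {N M p : ℕ} [NeZero p] (c : (Fin N → ℤ) → Matrix (Fin M) (Fin M) ℂ) :
    star (mulOp N M p c) = mulOp N M p (star c) := by
  symm
  rw [ContinuousLinearMap.star_eq_adjoint, ContinuousLinearMap.eq_adjoint_iff]
  intro u v
  rw [L2.inner_def, L2.inner_def]
  refine integral_congr_ae ?_
  filter_upwards [coeFn_mulOp p (star c) u, coeFn_mulOp p c v] with x h1 h2
  rw [h1, h2, Pi.star_apply, map_star, ContinuousLinearMap.star_eq_adjoint,
    ContinuousLinearMap.adjoint_inner_left]

lemma transl_mul_mulOp {N M p : ℕ} [NeZero p] (j : Fin N → ℤ)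
    (c : (Fin N → ℤ) → Matrix (Fin M) (Fin M) ℂ) :
    transl N M (gridVec N p j) * mulOp N M p c =
      mulOp N M p (fun r => c fun i => (r i + j i) % p) *
        transl N M (gridVec N p j) := by
  ext1 u
  set h := gridVec N p j with hh
  refine Lp.ext ((coeFn_transl h (mulOp N M p c u)).trans ?_)
  refine (ae_comp_add h (coeFn_mulOp p c u)).trans ?_
  filter_upwards [coeFn_mulOp p (fun r => c fun i => (r i + j i) % p) (transl N M h u),
    coeFn_transl h u] with x h1 h2
  rw [mul_apply_eq_comp, h1, h2, hh, cubeIdxZ_add (NeZero.pos p)]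

lemma mem_HsetF_iff {N M p : ℕ} [NeZero p] {T : L2 N M →L[ℂ] L2 N M} :
    T ∈ HsetF N M p ↔ ∃ C : (Fin N → Fin p) → (Fin N → ℤ) → Matrix (Fin M) (Fin M) ℂ,
      T = ∑ j, mulOp N M p (C j) * transl N M (hvecF N p j) := by
  have key (C : (Fin N → Fin p) → (Fin N → ℤ) → Matrix (Fin M) (Fin M) ℂ) (u : L2 N M) :
      ((∑ j, mulOp N M p (C j) * transl N M (hvecF N p j)) u :
        Torus N → EuclideanSpace ℂ (Fin M)) =ᵐ[volume] opOfF N M p C u := by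
    rw [_root_.sum_apply]
    refine (Lp.coeFn_finsetSum _ _).trans ?_
    have h1 := ae_all_iff.2 fun j => coeFn_mulOp p (C j) (transl N M (hvecF N p j) u)
    have h2 := ae_all_iff.2 fun j : Fin N → Fin p => coeFn_transl (hvecF N p j) u
    filter_upwards [h1, h2] with x h1 h2
    simp only [opOfF, Finset.sum_apply, mul_apply_eq_comp, h1, h2]
  constructor
  · rintro ⟨C, hC⟩
    refine ⟨C, ?_⟩
    ext1 u
    exact Lp.ext ((hC u).trans (key C u).symm)
  · rintro ⟨C, rfl⟩
    exact ⟨C, key C⟩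

lemma gridVec_zero (N p : ℕ) : gridVec N p 0 = 0 := by
  funext i
  simp [gridVec]

lemma gridVec_add {N p : ℕ} (j k : Fin N → ℤ) :
    gridVec N p (j + k) = gridVec N p j + gridVec N p k := by
  funext i
  simp only [gridVec, Pi.add_apply, Int.cast_add, add_div, AddCircle.coe_add]

lemma gridVec_neg {N p : ℕ} (j : Fin N → ℤ) : gridVec N p (-j) = -gridVec N p j := by
  funext i
  simp only [gridVec, Pi.neg_apply, Int.cast_neg, neg_div, AddCircle.coe_neg]

lemma gridVec_mul {N p m : ℕ} (hm : 0 < m) (j : Fin N → ℤ) :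
    gridVec N (p * m) (fun i => j i * m) = gridVec N p j := by
  funext i
  have hm' : (m : ℝ) ≠ 0 := by positivity
  simp only [gridVec, Int.cast_mul, Int.cast_natCast, Nat.cast_mul, mul_div_mul_right _ _ hm']

lemma gridVec_natCast {N p : ℕ} (j : Fin N → Fin p) :
    gridVec N p (fun i => ((j i : ℕ) : ℤ)) = hvecF N p j := by
  funext i
  simp [gridVec, hvecF]

lemma exists_hvecF_eq_gridVec {N p : ℕ} (hp : 0 < p) (j : Fin N → ℤ) :
    ∃ k, hvecF N p k = gridVec N p j := by
  have hp' : (p : ℝ) ≠ 0 := by positivity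
  have hpz : (0 : ℤ) < p := by exact_mod_cast hp
  refine ⟨fun i => ⟨(j i % p).toNat, ?_⟩, ?_⟩
  · have := Int.emod_nonneg (j i) hpz.ne'
    have := Int.emod_lt_of_pos (j i) hpz
    omega
  · funext i
    have h1 : (((j i % p).toNat : ℕ) : ℤ) = j i - p * (j i / p) := by
      rw [Int.toNat_of_nonneg (Int.emod_nonneg _ hpz.ne'), Int.emod_def]
    have h2 : (((j i % p).toNat : ℕ) : ℝ) = j i - p * ((j i / p : ℤ) : ℝ) := by exact_mod_cast h1
    simp only [hvecF, gridVec, h2]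
    rw [sub_div, mul_div_cancel_left₀ _ hp', AddCircle.coe_sub, sub_eq_self,
      AddCircle.coe_eq_zero_iff]
    exact ⟨j i / p, by simp⟩

lemma HsetF_zero_mem (N M p : ℕ) : 0 ∈ HsetF N M p :=
  ⟨0, fun u => (Lp.coeFn_zero _ _ _).trans (.of_forall fun x => by simp [opOfF])⟩

lemma HsetF_add_mem {N M p : ℕ} {S T : L2 N M →L[ℂ] L2 N M} (hS : S ∈ HsetF N M p)
    (hT : T ∈ HsetF N M p) : S + T ∈ HsetF N M p := by
  obtain ⟨C, hC⟩ := hS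
  obtain ⟨D, hD⟩ := hT
  refine ⟨C + D, fun u => (Lp.coeFn_add (S u) (T u)).trans ?_⟩
  filter_upwards [hC u, hD u] with x h1 h2
  simp [opOfF, h1, h2, Finset.sum_add_distrib]

lemma HsetF_smul_mem {N M p : ℕ} (a : ℂ) {T : L2 N M →L[ℂ] L2 N M}
    (hT : T ∈ HsetF N M p) : a • T ∈ HsetF N M p := by
  obtain ⟨C, hC⟩ := hT
  refine ⟨a • C, fun u => (Lp.coeFn_smul a (T u)).trans ?_⟩
  filter_upwards [hC u] with x h1
  simp [opOfF, h1, Finset.smul_sum]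

/-- `H^{1/p}` as a linear subspace. -/
def HSubmodule (N M p : ℕ) : Submodule ℂ (L2 N M →L[ℂ] L2 N M) where
  carrier := HsetF N M p
  zero_mem' := HsetF_zero_mem N M p
  add_mem' := HsetF_add_mem
  smul_mem' a _ := HsetF_smul_mem a

lemma mulOp_mul_transl_mem {N M p : ℕ} [NeZero p]
    (c : (Fin N → ℤ) → Matrix (Fin M) (Fin M) ℂ) (j : Fin N → ℤ) :
    mulOp N M p c * transl N M (gridVec N p j) ∈ HSubmodule N M p := by
  classical
  obtain ⟨k, hk⟩ := exists_hvecF_eq_gridVec (NeZero.pos p) j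
  refine ⟨Pi.single k c, fun u => ?_⟩
  filter_upwards [coeFn_mulOp p c (transl N M (gridVec N p j) u),
    coeFn_transl (gridVec N p j) u] with x h1 h2
  rw [mul_apply_eq_comp, h1, h2, opOfF, Finset.sum_eq_single k, Pi.single_eq_same, hk]
  · intro l _ hl
    simp [Pi.single_eq_of_ne hl]
  · simp

lemma one_mem_HSubmodule (N M p : ℕ) [NeZero p] : 1 ∈ HSubmodule N M p := by
  have h := mulOp_mul_transl_mem (N := N) (M := M) (p := p) 1 0
  rwa [mulOp_one, gridVec_zero, transl_zero, one_mul] at h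

lemma HSubmodule_induction {N M p : ℕ} [NeZero p] {K : Submodule ℂ (L2 N M →L[ℂ] L2 N M)}
    (h : ∀ c j, mulOp N M p c * transl N M (gridVec N p j) ∈ K) : HSubmodule N M p ≤ K := by
  intro T hT
  obtain ⟨C, rfl⟩ := mem_HsetF_iff.1 hT
  refine Submodule.sum_mem _ fun j _ => ?_
  rw [← gridVec_natCast]
  exact h _ _

lemma mul_mem_HSubmodule {N M p : ℕ} [NeZero p] {S T : L2 N M →L[ℂ] L2 N M}
    (hS : S ∈ HSubmodule N M p) (hT : T ∈ HSubmodule N M p) : S * T ∈ HSubmodule N M p := by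
  revert S
  change HSubmodule N M p ≤ (HSubmodule N M p).comap (LinearMap.mulRight ℂ T)
  refine HSubmodule_induction fun c j => ?_
  revert T
  change HSubmodule N M p ≤ (HSubmodule N M p).comap
    (LinearMap.mulLeft ℂ (mulOp N M p c * transl N M (gridVec N p j)))
  refine HSubmodule_induction fun d k => ?_
  rw [Submodule.mem_comap, LinearMap.mulLeft_apply, mul_assoc, ← mul_assoc (transl _ _ _),
    transl_mul_mulOp, mul_assoc, ← transl_add, ← gridVec_add, ← mul_assoc, mulOp_mul]
  exact mulOp_mul_transl_mem _ _

lemma star_mem_HSubmodule {N M p : ℕ} [NeZero p] {T : L2 N M →L[ℂ] L2 N M}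
    (hT : T ∈ HSubmodule N M p) : star T ∈ HSubmodule N M p := by
  obtain ⟨C, rfl⟩ := mem_HsetF_iff.1 hT
  rw [star_sum]
  refine Submodule.sum_mem _ fun j _ => ?_
  rw [← gridVec_natCast, star_mul, star_transl, star_mulOp, ← gridVec_neg, transl_mul_mulOp]
  exact mulOp_mul_transl_mem _ _

lemma mulOp_eq_mulOp_mul {N M p m : ℕ} [NeZero p] [NeZero m]
    (c : (Fin N → ℤ) → Matrix (Fin M) (Fin M) ℂ) :
    mulOp N M p c = mulOp N M (p * m) fun r => c fun i => r i / m := by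
  ext1 u
  refine Lp.ext ((coeFn_mulOp p c u).trans ?_)
  filter_upwards [coeFn_mulOp (p * m) (fun r => c fun i => r i / m) u] with x h
  rw [h, cubeIdxZ_of_mul (NeZero.pos m)]

lemma HSubmodule_mono {N M p q : ℕ} [NeZero q] (h : p ∣ q) :
    HSubmodule N M p ≤ HSubmodule N M q := by
  obtain ⟨m, rfl⟩ := h
  have hpm : p * m ≠ 0 := NeZero.ne _
  have : NeZero p := ⟨left_ne_zero_of_mul hpm⟩
  have : NeZero m := ⟨right_ne_zero_of_mul hpm⟩
  refine HSubmodule_induction fun c j => ?_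
  rw [mulOp_eq_mulOp_mul (m := m), ← gridVec_mul (NeZero.pos m)]
  exact mulOp_mul_transl_mem _ _

instance neZero_factorial (n : ℕ) : NeZero (Nat.factorial n) := ⟨n.factorial_ne_zero⟩

/-- The union of the increasing family `H^{1/n!}` as a star subalgebra. -/
def HUnion (N M : ℕ) : StarSubalgebra ℂ (L2 N M →L[ℂ] L2 N M) where
  carrier := ⋃ n : ℕ, HsetF N M (Nat.factorial (n + 1))
  mul_mem' {S T} hS hT := by
    obtain ⟨m, hm⟩ := Set.mem_iUnion.1 hS
    obtain ⟨n, hn⟩ := Set.mem_iUnion.1 hT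
    exact Set.mem_iUnion.2 ⟨max m n, mul_mem_HSubmodule
      (HSubmodule_mono (Nat.factorial_dvd_factorial (by omega)) hm)
      (HSubmodule_mono (Nat.factorial_dvd_factorial (by omega)) hn)⟩
  add_mem' {S T} hS hT := by
    obtain ⟨m, hm⟩ := Set.mem_iUnion.1 hS
    obtain ⟨n, hn⟩ := Set.mem_iUnion.1 hT
    exact Set.mem_iUnion.2 ⟨max m n, (HSubmodule _ _ _).add_mem
      (HSubmodule_mono (Nat.factorial_dvd_factorial (by omega)) hm)
      (HSubmodule_mono (Nat.factorial_dvd_factorial (by omega)) hn)⟩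
  algebraMap_mem' a := by
    rw [Algebra.algebraMap_eq_smul_one]
    exact Set.mem_iUnion.2 ⟨0, (HSubmodule _ _ _).smul_mem a (one_mem_HSubmodule _ _ _)⟩
  star_mem' {T} hT := by
    obtain ⟨n, hn⟩ := Set.mem_iUnion.1 hT
    exact Set.mem_iUnion.2 ⟨n, star_mem_HSubmodule hn⟩

lemma mem_HUnion {N M p : ℕ} [NeZero p] {T : L2 N M →L[ℂ] L2 N M}
    (hT : T ∈ HSubmodule N M p) : T ∈ HUnion N M :=
  Set.mem_iUnion.2 ⟨p, HSubmodule_mono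
    (Nat.dvd_factorial (NeZero.pos p) (Nat.le_succ p)) hT⟩

lemma mulOp_mem_HUnion {N M p : ℕ} [NeZero p] (c : (Fin N → ℤ) → Matrix (Fin M) (Fin M) ℂ) :
    mulOp N M p c ∈ HUnion N M := by
  have h := mulOp_mul_transl_mem (N := N) (M := M) (p := p) c 0
  rw [gridVec_zero, transl_zero, mul_one] at h
  exact mem_HUnion h

lemma transl_single_mem_HUnion {N M : ℕ} (i : Fin N) (h : ℚ) :
    transl N M (Pi.single i ((h : ℝ) : AddCircle (1 : ℝ))) ∈ HUnion N M := by
  have : NeZero h.den := ⟨h.den_nz⟩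
  have hv : gridVec N h.den (Pi.single i h.num) =
      Pi.single i ((h : ℝ) : AddCircle (1 : ℝ)) := by
    funext k
    rcases eq_or_ne k i with rfl | hk
    · simp only [gridVec, Pi.single_eq_same]
      congr 1
      exact_mod_cast congrArg (Rat.cast : ℚ → ℝ) (Rat.num_div_den h)
    · simp [gridVec, Pi.single_eq_of_ne hk]
  have := mulOp_mul_transl_mem (N := N) (M := M) (p := h.den) 1 (Pi.single i h.num)
  rw [mulOp_one, one_mul, hv] at this
  exact mem_HUnion this

lemma coeFn_smul_transl_sub_one {N M : ℕ} (k : Torus N) (a : ℂ) (u : L2 N M) :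
    ((a • (transl N M k - 1)) u : Torus N → EuclideanSpace ℂ (Fin M)) =ᵐ[volume]
      fun x => a • (u (x + k) - u x) := by
  filter_upwards [Lp.coeFn_smul a (transl N M k u - u), Lp.coeFn_sub (transl N M k u) u,
    coeFn_transl k u] with x h1 h2 h3
  refine h1.trans ?_
  rw [Pi.smul_apply, h2, Pi.sub_apply, h3]

lemma exists_norm_toEuclideanCLM_le (M : ℕ) : ∃ K > (0 : ℝ), ∀ δ : ℝ,
    ∀ A : Matrix (Fin M) (Fin M) ℂ, (∀ a b, ‖A a b‖ ≤ δ) → 0 ≤ δ →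
      ‖Matrix.toEuclideanCLM (𝕜 := ℂ) A‖ ≤ K * δ := by
  refine ⟨1 + ∑ a : Fin M, ∑ b : Fin M,
    ‖Matrix.toEuclideanCLM (𝕜 := ℂ) (Matrix.single a b 1)‖, by positivity,
    fun δ A hA hδ => ?_⟩
  have hsum : A = ∑ a, ∑ b, A a b • Matrix.single a b 1 := by
    simpa using Matrix.matrix_eq_sum_single A
  conv_lhs => rw [hsum]
  simp only [map_sum, map_smul]
  rw [add_mul, Finset.sum_mul]
  refine le_add_of_nonneg_of_le (by positivity) ((norm_sum_le _ _).trans ?_)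
  refine Finset.sum_le_sum fun a _ => ?_
  rw [Finset.sum_mul]
  refine (norm_sum_le _ _).trans (Finset.sum_le_sum fun b _ => ?_)
  rw [norm_smul, mul_comm]
  gcongr
  exact hA a b

lemma IsRatStep.exists_cubeStep {N M : ℕ} {S : Torus N → Matrix (Fin M) (Fin M) ℂ}
    (hS : IsRatStep N M S) : ∃ (p : ℕ) (c : (Fin N → ℤ) → Matrix (Fin M) (Fin M) ℂ),
      0 < p ∧ ∀ x, S x = c (cubeIdxZ N p x) := by
  classical
  obtain ⟨P, a, b, V, hV⟩ := hS
  set p : ℕ := ∏ n, ∏ i, (a n i).den * (b n i).den with hp_def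
  have hp : 0 < p := Finset.prod_pos fun n _ => Finset.prod_pos fun i _ =>
    Nat.mul_pos (a n i).den_pos (b n i).den_pos
  have hp' : (0 : ℝ) < p := by exact_mod_cast hp
  have hmul_den (q : ℚ) (hq : q.den ∣ p) : ∃ z : ℤ, (q : ℝ) * p = z := by
    obtain ⟨m, hm⟩ := hq
    refine ⟨q.num * m, ?_⟩
    have : q * p = q.num * m := by
      rw [hm, Nat.cast_mul, ← mul_assoc, Rat.mul_den_eq_num]
    exact_mod_cast congrArg (Rat.cast : ℚ → ℝ) this
  have hdvd (n : Fin P) (i : Fin N) : (a n i).den * (b n i).den ∣ p :=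
    (Finset.dvd_prod_of_mem (fun i => (a n i).den * (b n i).den) (Finset.mem_univ i)).trans
      (Finset.dvd_prod_of_mem (fun n => ∏ i, (a n i).den * (b n i).den) (Finset.mem_univ n))
  choose za hza using fun n i => hmul_den (a n i) ((Dvd.intro _ rfl).trans (hdvd n i))
  choose zb hzb using fun n i => hmul_den (b n i) ((Dvd.intro_left _ rfl).trans (hdvd n i))
  refine ⟨p, fun r => ∑ n, if ∀ i, za n i ≤ r i ∧ r i < zb n i then V n else 0, hp,
    fun x => ?_⟩
  rw [hV]
  refine Finset.sum_congr rfl fun n _ => ?_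
  rw [Set.indicator_apply]
  refine if_congr (forall_congr' fun i => ?_) rfl rfl
  rw [cubeIdxZ, Int.le_floor, Int.floor_lt, ← hza, ← hzb, mul_le_mul_iff_left₀ hp',
    mul_lt_mul_iff_left₀ hp']

lemma isRatStep_cubeStep {N M p : ℕ} (hp : 0 < p)
    (c : (Fin N → ℤ) → Matrix (Fin M) (Fin M) ℂ) :
    IsRatStep N M fun x => c (cubeIdxZ N p x) := by
  classical
  have hp' : (0 : ℝ) < p := by exact_mod_cast hp
  let e := Fintype.equivFin (Fin N → Fin p)
  refine ⟨_, fun n i => ((e.symm n i : ℕ) : ℚ) / p, fun n i => (((e.symm n i : ℕ) : ℚ) + 1) / p,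
    fun n => c fun i => (e.symm n i : ℕ), fun x => ?_⟩
  have hmem (k : Fin N → Fin p) : (∀ i, ((((k i : ℕ) : ℚ) / p : ℚ) : ℝ) ≤ lift1 (x i) ∧
      lift1 (x i) < (((((k i : ℕ) : ℚ) + 1) / p : ℚ) : ℝ)) ↔
      cubeIdxZ N p x = fun i => ((k i : ℕ) : ℤ) := by
    rw [funext_iff]
    refine forall_congr' fun i => ?_
    rw [cubeIdxZ, Int.floor_eq_iff]
    push_cast
    rw [div_le_iff₀ hp', lt_div_iff₀ hp']
  rw [← e.sum_comp]
  simp only [Set.indicator_apply, Set.mem_ofPred_eq, Equiv.symm_apply_apply, hmem]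
  have hx (i : Fin N) := cubeIdxZ_mem hp x i
  let k : Fin N → Fin p := fun i => ⟨(cubeIdxZ N p x i).toNat, by
    have := (hx i).1; have := (hx i).2; omega⟩
  have hk : cubeIdxZ N p x = fun i => ((k i : ℕ) : ℤ) :=
    funext fun i => (Int.toNat_of_nonneg (hx i).1).symm
  rw [Finset.sum_eq_single k, if_pos hk, ← hk]
  · intro l _ hl
    refine if_neg fun h => hl ?_
    funext i
    have := congrFun (hk.symm.trans h) i
    exact Fin.ext (by exact_mod_cast this.symm)
  · simp

lemma IsRatStep.isRegulated {N M : ℕ} {S : Torus N → Matrix (Fin M) (Fin M) ℂ}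
    (hS : IsRatStep N M S) : IsRegulated N M S :=
  fun ε hε => ⟨S, hS, fun x a b => by simpa using hε⟩

lemma mem_closure_HUnion_of_isRegulated {N M : ℕ} {S : Torus N → Matrix (Fin M) (Fin M) ℂ}
    (hS : IsRegulated N M S) {T : L2 N M →L[ℂ] L2 N M}
    (hT : ∀ u : L2 N M, (T u : Torus N → EuclideanSpace ℂ (Fin M)) =ᵐ[volume]
      fun x => Matrix.toEuclideanCLM (𝕜 := ℂ) (S x) (u x)) :
    T ∈ closure (HUnion N M : Set (L2 N M →L[ℂ] L2 N M)) := by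
  obtain ⟨K, hK, hKA⟩ := exists_norm_toEuclideanCLM_le M
  refine Metric.mem_closure_iff.2 fun ε hε => ?_
  have hδ : 0 < ε / (2 * K) := by positivity
  obtain ⟨S', hS', hSS'⟩ := hS _ hδ
  obtain ⟨p, c, hp, hc⟩ := hS'.exists_cubeStep
  have : NeZero p := ⟨hp.ne'⟩
  refine ⟨mulOp N M p c, mulOp_mem_HUnion c, ?_⟩
  rw [dist_eq_norm]
  refine lt_of_le_of_lt (b := ε / 2) ?_ (by linarith)
  refine ContinuousLinearMap.opNorm_le_bound _ (by positivity) fun u => ?_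
  refine Lp.norm_le_mul_norm_of_ae_le_mul ?_
  filter_upwards [Lp.coeFn_sub (T u) (mulOp N M p c u), hT u, coeFn_mulOp p c u] with x h1 h2 h3
  rw [_root_.sub_apply, h1, Pi.sub_apply, h2, h3, ← hc,
    ← _root_.sub_apply, ← map_sub]
  refine (ContinuousLinearMap.le_opNorm _ _).trans ?_
  gcongr
  refine (hKA (ε / (2 * K)) _ (fun a b => (hSS' x a b).le) hδ.le).trans_eq ?_
  field_simp

lemma PDEGen_subset_closure_HUnion (N M : ℕ) :
    PDEGen N M ⊆ closure (HUnion N M : Set (L2 N M →L[ℂ] L2 N M)) := by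
  rintro T (⟨i, h, -, hT⟩ | ⟨S, hS, hT⟩)
  · have hTeq : T = ((h : ℝ) : ℂ)⁻¹ •
        (transl N M (Pi.single i ((h : ℝ) : AddCircle (1 : ℝ))) - 1) := by
      ext1 u
      exact Lp.ext ((hT u).trans (coeFn_smul_transl_sub_one _ _ u).symm)
    rw [hTeq]
    exact subset_closure ((HUnion N M).smul_mem
      (sub_mem (transl_single_mem_HUnion i h) (one_mem _)) _)
  · exact mem_closure_HUnion_of_isRegulated hS hT

lemma transl_ratVec_mem_adjoin {N M : ℕ} (h : Fin N → ℚ) :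
    transl N M (fun i => ((h i : ℝ) : AddCircle (1 : ℝ))) ∈
      StarAlgebra.adjoin ℂ (PDEGen N M) := by
  have hsingle (i : Fin N) (q : ℚ) :
      transl N M (Pi.single i ((q : ℝ) : AddCircle (1 : ℝ))) ∈
        StarAlgebra.adjoin ℂ (PDEGen N M) := by
    rcases eq_or_ne q 0 with rfl | hq
    · simp only [Rat.cast_zero, AddCircle.coe_zero, Pi.single_zero, transl_zero]
      exact one_mem _
    have hq' : ((q : ℝ) : ℂ) ≠ 0 := by exact_mod_cast hq
    set τ := transl N M (Pi.single i ((q : ℝ) : AddCircle (1 : ℝ))) with hτ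
    have hD : ((q : ℝ) : ℂ)⁻¹ • (τ - 1) ∈ StarAlgebra.adjoin ℂ (PDEGen N M) :=
      StarAlgebra.subset_adjoin ℂ _
        (.inl ⟨i, q, hq, fun u => coeFn_smul_transl_sub_one _ _ u⟩)
    have := add_mem ((StarAlgebra.adjoin ℂ (PDEGen N M)).smul_mem hD ((q : ℝ) : ℂ))
      (one_mem (StarAlgebra.adjoin ℂ (PDEGen N M)))
    rwa [smul_inv_smul₀ hq', sub_add_cancel] at this
  have hsum (s : Finset (Fin N)) :
      transl N M (∑ i ∈ s, Pi.single i ((h i : ℝ) : AddCircle (1 : ℝ))) ∈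
        StarAlgebra.adjoin ℂ (PDEGen N M) := by
    classical
    induction s using Finset.induction_on with
    | empty =>
      rw [Finset.sum_empty, transl_zero]
      exact one_mem _
    | insert i s hi ih =>
      rw [Finset.sum_insert hi, transl_add]
      exact mul_mem (hsingle i (h i)) ih
  have := hsum Finset.univ
  rwa [Finset.univ_sum_single] at this

lemma HUnion_le_adjoin (N M : ℕ) : HUnion N M ≤ StarAlgebra.adjoin ℂ (PDEGen N M) := by
  intro T hT
  obtain ⟨n, hn⟩ := Set.mem_iUnion.1 hT
  refine HSubmodule_induction (p := (n + 1).factorial)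
    (K := (StarAlgebra.adjoin ℂ (PDEGen N M)).toSubalgebra.toSubmodule) (fun c j => ?_) hn
  refine mul_mem (S := StarSubalgebra ℂ (L2 N M →L[ℂ] L2 N M))
    (s := StarAlgebra.adjoin ℂ (PDEGen N M)) (StarAlgebra.subset_adjoin ℂ _ (.inr ⟨_,
      (isRatStep_cubeStep (NeZero.pos _) c).isRegulated, coeFn_mulOp _ c⟩)) ?_
  have := transl_ratVec_mem_adjoin (M := M) fun i => (j i : ℚ) / (n + 1).factorial
  simp only [Rat.cast_div, Rat.cast_intCast, Rat.cast_natCast] at this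
  exact this

/-- The C*-algebra generated in `B(L²(𝕋^N → ℂ^M))` by all finite difference
operators and all multiplication operators by regulated functions with rational
discontinuities equals the closure of the increasing union `⋃_{n≥1} H^{1/n!}`. -/
theorem stmt17 (N M : ℕ) :
    closure ((StarAlgebra.adjoin ℂ (PDEGen N M) :
        StarSubalgebra ℂ (L2 N M →L[ℂ] L2 N M)) : Set (L2 N M →L[ℂ] L2 N M))
      = closure (⋃ n : ℕ, HsetF N M (Nat.factorial (n + 1))) := by
  refine subset_antisymm (closure_minimal ?_ isClosed_closure) (closure_mono (HUnion_le_adjoin N M))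
  exact StarAlgebra.adjoin_le (S := (HUnion N M).topologicalClosure)
    (PDEGen_subset_closure_HUnion N M)
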